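/- arXiv:2511.02165 — 4 statements merged into one kernel-verified Lean document; each statement's English description precedes it below -/
import Mathlib

section
/- Let ν > 0 and τ₀ > 0 be real numbers, and let fbar and Δf be vectors in ℝ³ (EuclideanSpace ℝ (Fin 3)) satisfying the fixed-point equation fbar·(‖Δf‖² − 1) = ⟨Δf, fbar⟩ · Δf. Define Pbar(τ) = (2ν(τ + τ₀))^{-1/2} · fbar and ΔP(τ) = (2ν(τ + τ₀))^{-1/2} · Δf. Then for every τ > −τ₀, the function Pbar has derivative at τ equal to ν·(⟨ΔP(τ), Pbar(τ)⟩ · ΔP(τ) − ‖ΔP(τ)‖² · Pbar(τ)); that is, the scaling ansatz reduces the momentum loop equation ∂_τ Pbar = ν((ΔP·Pbar)ΔP − (ΔP)² Pbar) to the time-independent fixed-point equation. -/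
open scoped RealInnerProductSpace

/-- The scaling ansatz `P(τ) = f / √(2ν(τ+τ₀))` reduces the momentum loop equation
`∂_τ Pbar = ν((ΔP·Pbar)ΔP − (ΔP)² Pbar)` to the time-independent fixed-point equation
`fbar(‖Δf‖² − 1) = (Δf·fbar)Δf`. -/
theorem momentum_loop_scaling_ansatz
    (ν τ₀ : ℝ) (hν : 0 < ν) (hτ₀ : 0 < τ₀)
    (fbar Δf : EuclideanSpace ℝ (Fin 3))
    (hfix : (‖Δf‖ ^ 2 - 1) • fbar = ⟪Δf, fbar⟫ • Δf) :
    ∀ τ : ℝ, -τ₀ < τ →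
      HasDerivAt
        (fun τ : ℝ => ((2 * ν * (τ + τ₀)) ^ (-(1 / 2) : ℝ)) • fbar)
        (ν • (⟪((2 * ν * (τ + τ₀)) ^ (-(1 / 2) : ℝ)) • Δf,
                ((2 * ν * (τ + τ₀)) ^ (-(1 / 2) : ℝ)) • fbar⟫ •
              (((2 * ν * (τ + τ₀)) ^ (-(1 / 2) : ℝ)) • Δf)
            - ‖((2 * ν * (τ + τ₀)) ^ (-(1 / 2) : ℝ)) • Δf‖ ^ 2 •
              (((2 * ν * (τ + τ₀)) ^ (-(1 / 2) : ℝ)) • fbar))) τ := by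
  intro τ hτ
  have hpos : 0 < 2 * ν * (τ + τ₀) := mul_pos (by positivity) (by linarith)
  have hlin : HasDerivAt (fun τ : ℝ => 2 * ν * (τ + τ₀)) (2 * ν) τ := by
    simpa using ((hasDerivAt_id τ).add_const τ₀).const_mul (2 * ν)
  have hderiv := (hlin.rpow_const (p := -(1 / 2)) (Or.inl hpos.ne')).smul_const fbar
  have hcube : (2 * ν * (τ + τ₀)) ^ (-(1 / 2) - 1 : ℝ) =
      ((2 * ν * (τ + τ₀)) ^ (-(1 / 2) : ℝ)) ^ 3 := by
    rw [← Real.rpow_mul_natCast hpos.le]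
    norm_num
  rw [hcube] at hderiv
  refine hderiv.congr_deriv ?_
  generalize (2 * ν * (τ + τ₀)) ^ (-(1 / 2) : ℝ) = c
  rw [real_inner_smul_left, real_inner_smul_right, norm_smul, mul_pow, Real.norm_eq_abs, sq_abs]
  linear_combination (norm := module) (ν * c ^ 3) • hfix
end

section
/- Let f₊ and f₋ be vectors in ℝ³ (EuclideanSpace ℝ (Fin 3)), and set fbar = (f₊ + f₋)/2 and Δf = f₊ − f₋. Assume fbar and Δf are linearly independent and satisfy the fixed-point equation fbar·(‖Δf‖² − 1) = ⟨Δf, fbar⟩ · Δf. Then ‖Δf‖ = 1, ⟨Δf, fbar⟩ = 0, and consequently ‖f₊‖ = ‖f₋‖ (i.e., nontrivial solutions have all vectors on a common sphere, with unit-length discontinuity). -/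
open scoped RealInnerProductSpace

/-- Nontrivial (linearly independent) solutions of the fixed-point equation
`fbar(‖Δf‖² − 1) = (Δf·fbar)Δf` have unit discontinuity `‖Δf‖ = 1`,
orthogonality `⟪Δf, fbar⟫ = 0`, and hence `‖f₊‖ = ‖f₋‖`. -/
theorem fixed_point_nontrivial_solution
    (fplus fminus : EuclideanSpace ℝ (Fin 3))
    (fbar Δf : EuclideanSpace ℝ (Fin 3))
    (hbar : fbar = (2 : ℝ)⁻¹ • (fplus + fminus))
    (hΔ : Δf = fplus - fminus)
    (hind : LinearIndependent ℝ ![fbar, Δf])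
    (hfix : (‖Δf‖ ^ 2 - 1) • fbar = ⟪Δf, fbar⟫ • Δf) :
    ‖Δf‖ = 1 ∧ ⟪Δf, fbar⟫ = 0 ∧ ‖fplus‖ = ‖fminus‖ := by
  obtain ⟨hnorm, hinner⟩ := LinearIndependent.pair_iff.1 hind (‖Δf‖ ^ 2 - 1) (-⟪Δf, fbar⟫)
    (by rw [hfix, neg_smul, add_neg_cancel])
  have horth : ⟪Δf, fbar⟫ = 0 := neg_eq_zero.1 hinner
  refine ⟨(pow_eq_one_iff_of_nonneg (norm_nonneg _) two_ne_zero).1 (sub_eq_zero.1 hnorm),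
    horth, ?_⟩
  rw [hbar, hΔ, real_inner_smul_right, real_inner_comm] at horth
  exact (real_inner_add_sub_eq_zero_iff _ _).1
    ((mul_eq_zero.1 horth).resolve_left (by norm_num))
end

section
/- Define h : ℝ → ℝ by h(x) = 1 + x − √(x² − x). Then h(1) = 2, and the difference quotient (h(x) − 2)/(x − 1) tends to −∞ as x → 1 from the right (i.e., along the filter 𝓝[>] 1 the quotient tends to the filter atBot). Hence the Pr > 1 branch of the MHD wavevector scale has an infinite one-sided slope at Pr = 1, so the piecewise scale function is continuous but not differentiable there, signaling a first-order phase transition. -/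
open Real Filter

/-- To the right of `1`, the difference quotient of `1 + x − √(x² − x)` at `1` has the closed form
`1 − √(1 + (x − 1)⁻¹)`. -/
lemma mhd_branch_slope_eq {x : ℝ} (hx : 1 < x) :
    ((1 + x - Real.sqrt (x ^ 2 - x)) - 2) / (x - 1) = 1 - Real.sqrt (1 + (x - 1)⁻¹) := by
  have hpos : 0 < x - 1 := sub_pos.2 hx
  have hfactor : x ^ 2 - x = (x - 1) ^ 2 * (1 + (x - 1)⁻¹) := by
    field_simp
    ring
  rw [hfactor, Real.sqrt_mul (sq_nonneg _), Real.sqrt_sq hpos.le, div_eq_iff hpos.ne']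
  ring

/-- The `Pr > 1` branch `h(x) = 1 + x − √(x² − x)` of the MHD wavevector scale satisfies
`h(1) = 2` and its difference quotient at `1` tends to `−∞` from the right: an infinite
one-sided slope, signaling a first-order phase transition. -/
theorem mhd_branch_infinite_slope :
    (1 + (1 : ℝ) - Real.sqrt ((1 : ℝ) ^ 2 - 1) = 2) ∧
    Tendsto (fun x : ℝ => ((1 + x - Real.sqrt (x ^ 2 - x)) - 2) / (x - 1))
      (nhdsWithin 1 (Set.Ioi 1)) atBot := by
  refine ⟨by norm_num, ?_⟩
  have hsub : Tendsto (fun x : ℝ => x - 1) (nhdsWithin 1 (Set.Ioi 1))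
      (nhdsWithin 0 (Set.Ioi 0)) := by
    refine tendsto_nhdsWithin_iff.2 ⟨?_, ?_⟩
    · exact ((continuous_sub_right (1 : ℝ)).tendsto' 1 0 (sub_self 1)).mono_left nhdsWithin_le_nhds
    · filter_upwards [self_mem_nhdsWithin] with x hx using sub_pos.2 (Set.mem_Ioi.1 hx)
  have hsqrt : Tendsto (fun x : ℝ => Real.sqrt (1 + (x - 1)⁻¹)) (nhdsWithin 1 (Set.Ioi 1)) atTop :=
    Real.tendsto_sqrt_atTop.comp
      (tendsto_atTop_add_const_left _ 1 (tendsto_inv_nhdsGT_zero.comp hsub))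
  have hlim := tendsto_atBot_add_const_left _ (1 : ℝ) (tendsto_neg_atTop_atBot.comp hsqrt)
  refine hlim.congr' ?_
  filter_upwards [self_mem_nhdsWithin] with x hx
  rw [mhd_branch_slope_eq hx, sub_eq_add_neg, Function.comp_apply]
end

section
/- Let β ∈ (0, 2π), R = 1/(2 sin(β/2)), let N be a positive integer, σ : ℕ → ℝ with σ(l) ∈ {−1, 1} for all l, and define cumulative angles α(k) = β·Σ_{l=1}^{k} σ(l). Let Ω be a 3×3 real orthogonal matrix and define f(k) ∈ ℝ³ by f(k) = Ω · (R·cos α(k), R·sin α(k), 0). Then for every k: (i) ‖f(k)‖ = R, so in particular ‖f(k+1)‖² = ‖f(k)‖²; (ii) ‖f(k+1) − f(k)‖² = 1; and (iii) ⟨f(k+1) + f(k), f(k+1) − f(k)⟩ = 0. Hence the Euler-ensemble configuration satisfies the recurrent equations (f(θ+) + f(θ−))·(f(θ+) − f(θ−)) = 0 and (f(θ+) − f(θ−))² = 1 at every step. -/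
open Real
open scoped RealInnerProductSpace

theorem Matrix.inner_toLp_mulVec_of_mem_orthogonalGroup {n : Type*} [Fintype n] [DecidableEq n]
    {A : Matrix n n ℝ} (hA : A ∈ Matrix.orthogonalGroup n ℝ) (u v : n → ℝ) :
    ⟪WithLp.toLp 2 (A.mulVec u), WithLp.toLp 2 (A.mulVec v)⟫ = u ⬝ᵥ v := by
  rw [EuclideanSpace.inner_toLp_toLp, star_trivial, Matrix.dotProduct_mulVec,
    ← Matrix.mulVec_transpose, Matrix.mulVec_mulVec,
    (Matrix.mem_orthogonalGroup_iff' n ℝ).1 hA, Matrix.one_mulVec, dotProduct_comm]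

/-- The Euler-ensemble configuration `f(k) = Ω·(R cos α_k, R sin α_k, 0)` with
`R = 1/(2 sin(β/2))`, Ising steps `σ_l = ±1`, cumulative angles `α_k = β Σ_{l≤k} σ_l`,
and orthogonal `Ω` satisfies the recurrent equations of the fixed point: all vectors
lie on the sphere of radius `R`, consecutive differences have unit length, and
`⟨f(k+1) + f(k), f(k+1) − f(k)⟩ = 0`. -/
theorem euler_ensemble_satisfies_recurrent_equations
    (β : ℝ) (hβ0 : 0 < β) (hβ2 : β < 2 * π)
    (R : ℝ) (hR : R = 1 / (2 * Real.sin (β / 2)))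
    (N : ℕ) (hN : 0 < N)
    (σ : ℕ → ℝ) (hσ : ∀ l, σ l = -1 ∨ σ l = 1)
    (α : ℕ → ℝ) (hα : ∀ k, α k = β * ∑ l ∈ Finset.Icc 1 k, σ l)
    (Ω : Matrix (Fin 3) (Fin 3) ℝ) (hΩ : Ω ∈ Matrix.orthogonalGroup (Fin 3) ℝ)
    (f : ℕ → EuclideanSpace ℝ (Fin 3))
    (hf : ∀ k, f k = (WithLp.equiv 2 (Fin 3 → ℝ)).symm
      (Ω.mulVec ![R * Real.cos (α k), R * Real.sin (α k), 0])) :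
    ∀ k : ℕ,
      ‖f k‖ = R ∧
      ‖f (k + 1)‖ ^ 2 = ‖f k‖ ^ 2 ∧
      ‖f (k + 1) - f k‖ ^ 2 = 1 ∧
      ⟪f (k + 1) + f k, f (k + 1) - f k⟫ = 0 := by
  have inner_f (i j : ℕ) : ⟪f i, f j⟫ = R ^ 2 * Real.cos (α i - α j) := by
    rw [hf, hf, WithLp.equiv_symm_apply,
      Matrix.inner_toLp_mulVec_of_mem_orthogonalGroup hΩ, Real.cos_sub]
    simp only [dotProduct, Fin.sum_univ_three, Matrix.cons_val]
    ring
  have hsin : 0 < Real.sin (β / 2) := Real.sin_pos_of_pos_of_lt_pi (by linarith) (by linarith)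
  have hR0 : 0 ≤ R := by rw [hR]; positivity
  have norm_f (i : ℕ) : ‖f i‖ = R := by
    rw [← sq_eq_sq₀ (norm_nonneg _) hR0, ← real_inner_self_eq_norm_sq, inner_f]
    simp
  have hcos (k : ℕ) : Real.cos (α (k + 1) - α k) = Real.cos β := by
    have hstep : α (k + 1) - α k = β * σ (k + 1) := by
      rw [hα, hα, Finset.sum_Icc_succ_top (by omega)]
      ring
    rw [hstep]
    rcases hσ (k + 1) with h | h <;> simp [h]
  have hchord : 2 * R ^ 2 * (1 - Real.cos β) = 1 := by
    have hβ : Real.cos β = 1 - 2 * Real.sin (β / 2) ^ 2 := by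
      rw [← Real.cos_two_mul_eq_one_sub, mul_div_cancel₀ β two_ne_zero]
    rw [hβ, hR]
    field_simp
    ring
  intro k
  refine ⟨norm_f k, by rw [norm_f, norm_f], ?_, ?_⟩
  · rw [norm_sub_sq_real, norm_f, norm_f, inner_f, hcos]
    linarith
  · rw [real_inner_add_sub_eq_zero_iff, norm_f, norm_f]
end
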